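/- Let n ≥ 1, let 𝐗 ⊆ ℝ≥0^n be an interval, and let C(𝐚) be an interval circulant matrix such that Â ∈ C(𝐚). Then there exist A ∈ C(𝐚) and x ∈ 𝐗 with x ∈ Attr(A) (i.e., C(𝐚) is weakly tolerance 𝐗-robust) if and only if there exists x ∈ 𝐗 such that λ(Â)·(Â^{n²}⊗x) = Â^{n²+1}⊗x. -/

import Mathlib

open scoped NNReal Classical

namespace MaxAlg

variable {n : ℕ}

/-- cyclic successor on `Fin k` -/
def cyc {k : ℕ} (l : Fin k) : Fin k := ⟨(l.val + 1) % k, Nat.mod_lt _ l.pos⟩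

/-- max-algebraic matrix product -/
noncomputable def mmul (A B : Matrix (Fin n) (Fin n) ℝ≥0) : Matrix (Fin n) (Fin n) ℝ≥0 :=
  fun i k => Finset.univ.sup fun j => A i j * B j k

/-- max-algebraic identity matrix -/
def mId (n : ℕ) : Matrix (Fin n) (Fin n) ℝ≥0 := fun i j => if i = j then 1 else 0

/-- max-algebraic matrix power -/
noncomputable def mpow (A : Matrix (Fin n) (Fin n) ℝ≥0) : ℕ → Matrix (Fin n) (Fin n) ℝ≥0
  | 0 => mId n
  | t + 1 => mmul (mpow A t) A

/-- max-algebraic matrix-vector product -/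
noncomputable def mvec (A : Matrix (Fin n) (Fin n) ℝ≥0) (x : Fin n → ℝ≥0) : Fin n → ℝ≥0 :=
  fun i => Finset.univ.sup fun j => A i j * x j

/-- geometric mean of the cycle `c` of length `k` -/
noncomputable def cycMean (A : Matrix (Fin n) (Fin n) ℝ≥0) (k : ℕ) (c : Fin k → Fin n) : ℝ≥0 :=
  (∏ l : Fin k, A (c l) (c (cyc l))) ^ ((1 : ℝ) / (k : ℝ))

/-- maximum cycle geometric mean λ(A) -/
noncomputable def lam (A : Matrix (Fin n) (Fin n) ℝ≥0) : ℝ≥0 :=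
  (Finset.Icc 1 n).sup fun k => Finset.univ.sup fun c : Fin k → Fin n => cycMean A k c

/-- attraction cone Attr(A) -/
def Attr (A : Matrix (Fin n) (Fin n) ℝ≥0) : Set (Fin n → ℝ≥0) :=
  {x | ∃ s : ℕ, mvec (mpow A (s + 1)) x = fun i => lam A * mvec (mpow A s) x i}

/-- circulant matrix built from the vector of values `a_0, …, a_{n-1}` -/
def circ (a : Fin n → ℝ≥0) : Matrix (Fin n) (Fin n) ℝ≥0 := fun i j => a (j - i)

/-- A is a circulant matrix -/
def IsCirculant (A : Matrix (Fin n) (Fin n) ℝ≥0) : Prop := ∃ a : Fin n → ℝ≥0, A = circ a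

/-- (i,j) is a critical edge of A -/
def IsCritEdge (A : Matrix (Fin n) (Fin n) ℝ≥0) (i j : Fin n) : Prop :=
  A i j ≠ 0 ∧ ∃ (k : ℕ) (c : Fin k → Fin n), 1 ≤ k ∧
    (∀ l, A (c l) (c (cyc l)) ≠ 0) ∧
    cycMean A k c = lam A ∧ ∃ l, c l = i ∧ c (cyc l) = j

/-- there is a walk of length ≥ 1 from i to j in crit(A) -/
def CritWalk (A : Matrix (Fin n) (Fin n) ℝ≥0) (i j : Fin n) : Prop :=
  ∃ l : ℕ, 1 ≤ l ∧ ∃ w : ℕ → Fin n, w 0 = i ∧ w l = j ∧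
    ∀ r < l, IsCritEdge A (w r) (w (r + 1))

/-- node i lies on a critical cycle of A -/
def OnCritCycle (A : Matrix (Fin n) (Fin n) ℝ≥0) (i : Fin n) : Prop :=
  ∃ (k : ℕ) (c : Fin k → Fin n), 1 ≤ k ∧
    (∀ l, A (c l) (c (cyc l)) ≠ 0) ∧
    cycMean A k c = lam A ∧ ∃ l, c l = i

/-- family of one-dimensional intervals with bounds `lo`, `hi`,
each of one of the four forms -/
def IsIntervalFam (S : Fin n → Set ℝ≥0) (lo hi : Fin n → ℝ≥0) : Prop :=
  ∀ i, (S i).Nonempty ∧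
    (S i = Set.Icc (lo i) (hi i) ∨ S i = Set.Ico (lo i) (hi i) ∨
     S i = Set.Ioc (lo i) (hi i) ∨ S i = Set.Ioo (lo i) (hi i))

/-- the interval 𝐗 ⊆ ℝ≥0ⁿ determined by the family S -/
def box (S : Fin n → Set ℝ≥0) : Set (Fin n → ℝ≥0) := {x | ∀ i, x i ∈ S i}

/-- vertex x^{(k)}: x̄ in coordinate k and x̲ elsewhere -/
def vtx (lo hi : Fin n → ℝ≥0) (k : Fin n) : Fin n → ℝ≥0 :=
  Function.update lo k (hi k)

/-- the interval circulant matrix C(𝐚) determined by the interval family Sa -/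
def Cset (Sa : Fin n → Set ℝ≥0) : Set (Matrix (Fin n) (Fin n) ℝ≥0) :=
  {A | ∃ a : Fin n → ℝ≥0, (∀ k, a k ∈ Sa k) ∧ A = circ a}

/-- the matrix Â, with â_k = min(a̲, ā_k) where a̲ = max_k a̲_k -/
noncomputable def Ahat (alo ahi : Fin n → ℝ≥0) : Matrix (Fin n) (Fin n) ℝ≥0 :=
  circ fun k => min (Finset.univ.sup alo) (ahi k)

/-- the matrix A^{(k)} = Circulant(a̲_0,…,a̲_{k−1}, ā_k, a̲_{k+1},…,a̲_{n−1}) -/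
def Ak (alo ahi : Fin n → ℝ≥0) (k : Fin n) : Matrix (Fin n) (Fin n) ℝ≥0 :=
  circ (Function.update alo k (ahi k))

section Correlation

variable {G : Type*} [AddCommGroup G]

/-- Translation of a function on `G`. -/
def shift (k : G) (x : G → ℝ≥0) : G → ℝ≥0 := fun i => x (i + k)

theorem shift_iterate (k : G) (x : G → ℝ≥0) (t : ℕ) (i : G) :
    (shift k)^[t] x i = x (i + t • k) := by
  induction t generalizing i with
  | zero => simp
  | succ t ih =>
    rw [Function.iterate_succ_apply', shift, ih, succ_nsmul', add_assoc]

variable [Fintype G]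

/-- Max-algebraic correlation of `x` with the weight `c` on a finite abelian group. -/
noncomputable def corr (c x : G → ℝ≥0) : G → ℝ≥0 :=
  fun i => Finset.univ.sup fun k => c k * x (i + k)

theorem mul_le_corr (c x : G → ℝ≥0) (i k : G) : c k * x (i + k) ≤ corr c x i :=
  Finset.le_sup (f := fun k => c k * x (i + k)) (Finset.mem_univ k)

theorem corr_le_iff {c x : G → ℝ≥0} {i : G} {v : ℝ≥0} :
    corr c x i ≤ v ↔ ∀ k, c k * x (i + k) ≤ v := by
  simp [corr]

theorem exists_corr_eq (c x : G → ℝ≥0) (i : G) : ∃ k, corr c x i = c k * x (i + k) := by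
  obtain ⟨k, -, hk⟩ := Finset.exists_mem_eq_sup Finset.univ Finset.univ_nonempty
    (fun k => c k * x (i + k))
  exact ⟨k, hk⟩

theorem corr_mono_left {c d : G → ℝ≥0} (h : c ≤ d) (x : G → ℝ≥0) : corr c x ≤ corr d x :=
  fun i => corr_le_iff.2 fun k => (mul_le_mul_left (h k) _).trans (mul_le_corr d x i k)

theorem corr_mono (c : G → ℝ≥0) : Monotone (corr c) :=
  fun _ y h i => corr_le_iff.2 fun k => (mul_le_mul_right (h _) _).trans (mul_le_corr c y i k)

theorem corr_smul (m : ℝ≥0) (c x : G → ℝ≥0) : corr c (m • x) = m • corr c x := by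
  funext i
  simp only [corr, Pi.smul_apply, smul_eq_mul, NNReal.mul_finset_sup]
  exact Finset.sup_congr rfl fun k _ => by ring

theorem smul_corr (m : ℝ≥0) (c x : G → ℝ≥0) : corr (m • c) x = m • corr c x := by
  funext i
  simp only [corr, Pi.smul_apply, smul_eq_mul, NNReal.mul_finset_sup]
  exact Finset.sup_congr rfl fun k _ => by ring

theorem smul_corr_iterate (m : ℝ≥0) (c x : G → ℝ≥0) (t : ℕ) :
    (corr (m • c))^[t] x = m ^ t • (corr c)^[t] x := by
  induction t with
  | zero => simp
  | succ t ih =>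
    rw [Function.iterate_succ_apply', Function.iterate_succ_apply', ih, smul_corr, corr_smul,
      smul_smul, pow_succ']

theorem smul_corr_iterate_succ_eq_iff {m : ℝ≥0} (hm : 0 < m) (c x : G → ℝ≥0) (t : ℕ) :
    (corr (m • c))^[t + 1] x = m • (corr (m • c))^[t] x ↔
      (corr c)^[t + 1] x = (corr c)^[t] x := by
  rw [smul_corr_iterate, smul_corr_iterate, smul_smul, ← pow_succ',
    (smul_right_injective (G → ℝ≥0) (pow_pos hm (t + 1)).ne').eq_iff]

theorem corr_comm (c d : G → ℝ≥0) : Function.Commute (corr c) (corr d) := by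
  intro x
  funext i
  simp only [corr, NNReal.mul_finset_sup]
  rw [Finset.sup_comm]
  refine Finset.sup_congr rfl fun k _ => Finset.sup_congr rfl fun l _ => ?_
  rw [add_right_comm]
  ring

theorem apply_add_nsmul_le_corr_iterate {c : G → ℝ≥0} {k : G} (hk : c k = 1) (x : G → ℝ≥0)
    (t : ℕ) (i : G) : x (i + t • k) ≤ (corr c)^[t] x i := by
  induction t generalizing i with
  | zero => simp
  | succ t ih =>
    rw [Function.iterate_succ_apply']
    refine le_trans ?_ (mul_le_corr c _ i k)
    rw [hk, one_mul, succ_nsmul', ← add_assoc]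
    exact ih _

theorem le_corr_iterate_card_mul {c : G → ℝ≥0} {k : G} (hk : c k = 1) (x : G → ℝ≥0) (r : ℕ) :
    x ≤ (corr c)^[Fintype.card G * r] x := by
  intro i
  simpa [mul_nsmul] using apply_add_nsmul_le_corr_iterate hk x (Fintype.card G * r) i

theorem walk_le_corr_iterate (c x : G → ℝ≥0) (w : ℕ → G) (t : ℕ) :
    (∏ r ∈ Finset.range t, c (w (r + 1) - w r)) * x (w t) ≤ (corr c)^[t] x (w 0) := by
  induction t generalizing x with
  | zero => simp
  | succ t ih =>
    rw [Function.iterate_succ_apply, Finset.prod_range_succ, mul_assoc]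
    refine le_trans (mul_le_mul_right ?_ _) (ih (corr c x))
    simpa using mul_le_corr c x (w t) (w (t + 1) - w t)

theorem exists_walk_eq_corr_iterate (c x : G → ℝ≥0) (t : ℕ) (i : G) :
    ∃ w : ℕ → G, w 0 = i ∧
      (corr c)^[t] x i = (∏ r ∈ Finset.range t, c (w (r + 1) - w r)) * x (w t) := by
  induction t generalizing i with
  | zero => exact ⟨fun _ => i, rfl, by simp⟩
  | succ t ih =>
    obtain ⟨k, hk⟩ := exists_corr_eq c ((corr c)^[t] x) i
    obtain ⟨w, hw, h⟩ := ih (i + k)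
    refine ⟨fun r => Nat.casesOn r i w, rfl, ?_⟩
    rw [Function.iterate_succ_apply', hk, h, Finset.prod_range_succ']
    have h0 : (Nat.casesOn 0 i w : G) = i := rfl
    simp only [hw, h0, add_sub_cancel_left]
    ring

theorem corr_iterate_le_of_le {c : G → ℝ≥0} (h0 : c 0 = 1) (x : G → ℝ≥0) {s t : ℕ}
    (hst : s ≤ t) : (corr c)^[s] x ≤ (corr c)^[t] x := by
  refine monotone_nat_of_le_succ (f := fun t => (corr c)^[t] x) (fun t i => ?_) hst
  simp only [Function.iterate_succ_apply']
  simpa [h0] using mul_le_corr c ((corr c)^[t] x) i 0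

/-- A walk visiting a vertex twice may be shortened, since all weights are at most one. -/
theorem corr_iterate_card {c : G → ℝ≥0} (h0 : c 0 = 1) (h1 : c ≤ 1) (x : G → ℝ≥0) :
    (corr c)^[Fintype.card G] x = (corr c)^[Fintype.card G - 1] x := by
  refine le_antisymm (fun i => ?_) (corr_iterate_le_of_le h0 x (Nat.sub_le _ _))
  obtain ⟨w, rfl, hw⟩ := exists_walk_eq_corr_iterate c x (Fintype.card G) i
  obtain ⟨a, b, hab, hwab⟩ : ∃ a b : Fin (Fintype.card G + 1), a < b ∧ w a = w b := by
    obtain ⟨a, b, hne, h⟩ := Fintype.exists_ne_map_eq_of_card_lt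
      (fun a : Fin (Fintype.card G + 1) => w a) (by simp)
    rcases lt_or_gt_of_ne hne with hlt | hlt
    · exact ⟨a, b, hlt, h⟩
    · exact ⟨b, a, hlt, h.symm⟩
  obtain ⟨a, ha⟩ := a
  obtain ⟨b, hb⟩ := b
  simp only [Fin.mk_lt_mk] at hab hwab
  obtain ⟨e, he⟩ := Nat.exists_eq_add_of_le (Nat.lt_succ_iff.1 hb)
  obtain ⟨f, rfl⟩ := Nat.exists_eq_add_of_le hab.le
  refine le_trans ?_ (corr_iterate_le_of_le h0 x (show a + e ≤ Fintype.card G - 1 by lia) (w 0))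
  rw [hw, he, Finset.prod_range_add, Finset.prod_range_add, Function.iterate_add_apply]
  refine le_trans ?_ (walk_le_corr_iterate c _ w a)
  rw [mul_assoc, mul_assoc]
  refine mul_le_mul_right ?_ _
  have hloop : ∏ r ∈ Finset.range f, c (w (a + r + 1) - w (a + r)) ≤ 1 :=
    Finset.prod_le_one' fun r _ => h1 _
  refine (mul_le_of_le_one_left (zero_le) hloop).trans ?_
  rw [hwab]
  exact walk_le_corr_iterate c x (fun r => w (a + f + r)) e

theorem corr_iterate_eq_of_card_le {c : G → ℝ≥0} (h0 : c 0 = 1) (h1 : c ≤ 1) (x : G → ℝ≥0)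
    {t : ℕ} (ht : Fintype.card G - 1 ≤ t) :
    (corr c)^[t] x = (corr c)^[Fintype.card G - 1] x := by
  induction t, ht using Nat.le_induction with
  | base => rfl
  | succ t _ ih =>
    rw [Function.iterate_succ_apply', ih, ← Function.iterate_succ_apply' (corr c),
      Nat.succ_eq_add_one, Nat.sub_add_cancel Fintype.card_pos, corr_iterate_card h0 h1]

theorem shift_comp_corr (c : G → ℝ≥0) (k : G) :
    shift k ∘ corr (fun d => c (d + k)) = corr c := by
  funext x i
  refine le_antisymm (corr_le_iff.2 fun d => ?_) (corr_le_iff.2 fun d => ?_)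
  · simpa [add_assoc, add_comm k d] using mul_le_corr c x i (d + k)
  · simpa [shift] using mul_le_corr (fun d => c (d + k)) x (i + k) (d - k)

theorem shift_commute_corr (c : G → ℝ≥0) (k : G) :
    Function.Commute (shift k) (corr c) := by
  intro x
  funext i
  exact Finset.sup_congr rfl fun d _ => by rw [shift, add_right_comm]

theorem corr_iterate_add_card {c : G → ℝ≥0} {k : G} (hk : c k = 1) (h1 : c ≤ 1)
    (x : G → ℝ≥0) {t : ℕ} (ht : Fintype.card G - 1 ≤ t) :
    (corr c)^[t + Fintype.card G] x = (corr c)^[t] x := by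
  have hsplit (s : ℕ) : (corr c)^[s] = (shift k)^[s] ∘ (corr fun d => c (d + k))^[s] := by
    rw [← (shift_commute_corr _ k).comp_iterate, shift_comp_corr]
  have h0 : (fun d => c (d + k)) 0 = 1 := by simpa using hk
  have h1' : (fun d => c (d + k)) ≤ 1 := fun d => h1 (d + k)
  funext i
  simp only [hsplit, Function.comp_apply, shift_iterate, add_nsmul, card_nsmul_eq_zero, add_zero,
    corr_iterate_eq_of_card_le h0 h1' x ht,
    corr_iterate_eq_of_card_le h0 h1' x (ht.trans (Nat.le_add_right _ _))]

theorem corr_iterate_add_card_mul {c : G → ℝ≥0} {k : G} (hk : c k = 1) (h1 : c ≤ 1)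
    (x : G → ℝ≥0) {t : ℕ} (ht : Fintype.card G - 1 ≤ t) (r : ℕ) :
    (corr c)^[t + Fintype.card G * r] x = (corr c)^[t] x := by
  induction r with
  | zero => simp
  | succ r ih =>
    rw [Nat.mul_succ, ← add_assoc, corr_iterate_add_card hk h1 x (by lia), ih]

/-- If `x` is attracted to the fixed points of a normalised correlation operator, then it is
attracted to the fixed points of every larger one, within `card G - 1` steps. -/
theorem corr_iterate_succ_eq_of_le {b c : G → ℝ≥0} {k : G} (hbc : b ≤ c) (hk : b k = 1)
    (h1 : c ≤ 1) {x : G → ℝ≥0} {s : ℕ} (hx : (corr b)^[s + 1] x = (corr b)^[s] x)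
    {t : ℕ} (ht : Fintype.card G - 1 ≤ t) :
    (corr c)^[t + 1] x = (corr c)^[t] x := by
  have hck : c k = 1 := le_antisymm (h1 k) (hk ▸ hbc k)
  have hpos : 0 < Fintype.card G := Fintype.card_pos
  set y := (corr b)^[Fintype.card G * s] x with hy
  have hby : corr b y = y := by
    obtain ⟨e, he⟩ := Nat.exists_eq_add_of_le' (Nat.le_mul_of_pos_left s hpos)
    rw [hy, ← Function.iterate_succ_apply' (corr b), he, Nat.succ_eq_add_one, add_assoc,
      Function.iterate_add_apply, hx, ← Function.iterate_add_apply]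
  have hxy : (corr c)^[t] y = (corr c)^[t] x := by
    refine le_antisymm ?_ ((corr_mono c).iterate t (le_corr_iterate_card_mul hk x s))
    rw [← corr_iterate_add_card_mul hck h1 x ht s, Function.iterate_add_apply]
    exact (corr_mono c).iterate t
      ((corr_mono b).iterate_le_of_le (corr_mono_left hbc) _ x)
  set z := (corr c)^[t] x with hz
  have hbz : corr b z = z := by
    rw [← hxy, (corr_comm b c).iterate_right t y, hby]
  have hzc : z ≤ corr c z := hbz.symm.le.trans (corr_mono_left hbc z)
  rw [Function.iterate_succ_apply', ← hz]
  refine le_antisymm ?_ hzc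
  calc corr c z = (corr c)^[1] z := rfl
    _ ≤ (corr c)^[Fintype.card G] z := (corr_mono c).monotone_iterate_of_le_map hzc hpos
    _ = z := by
      rw [hz, ← Function.iterate_add_apply, add_comm, corr_iterate_add_card hck h1 x ht]

end Correlation

theorem mvec_mmul (A B : Matrix (Fin n) (Fin n) ℝ≥0) (x : Fin n → ℝ≥0) :
    mvec (mmul A B) x = mvec A (mvec B x) := by
  funext i
  simp only [mvec, mmul, NNReal.mul_finset_sup, NNReal.finset_sup_mul]
  rw [Finset.sup_comm]
  simp only [mul_assoc]

theorem mvec_mId (x : Fin n → ℝ≥0) : mvec (mId n) x = x := by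
  funext i
  refine le_antisymm (Finset.sup_le fun j _ => ?_) ?_
  · by_cases h : i = j <;> simp [mId, h]
  · simpa [mId, mvec] using Finset.le_sup (f := fun j => mId n i j * x j) (Finset.mem_univ i)

theorem mvec_mpow (A : Matrix (Fin n) (Fin n) ℝ≥0) (t : ℕ) (x : Fin n → ℝ≥0) :
    mvec (mpow A t) x = (mvec A)^[t] x := by
  induction t generalizing x with
  | zero => exact mvec_mId x
  | succ t ih => rw [mpow, mvec_mmul, ih, Function.iterate_succ_apply]

theorem mvec_circ [NeZero n] (a : Fin n → ℝ≥0) : mvec (circ a) = corr a := by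
  funext x i
  refine le_antisymm (Finset.sup_le fun j _ => ?_) (corr_le_iff.2 fun k => ?_)
  · simpa [circ] using mul_le_corr a x i (j - i)
  · simpa [circ, mvec] using
      Finset.le_sup (f := fun j => circ a i j * x j) (Finset.mem_univ (i + k))

theorem cycMean_circ_le (a : Fin n → ℝ≥0) {k : ℕ} (hk : k ≠ 0) (c : Fin k → Fin n) :
    cycMean (circ a) k c ≤ Finset.univ.sup a := by
  have h : ∏ l : Fin k, circ a (c l) (c (cyc l)) ≤ Finset.univ.sup a ^ k := by
    simpa using Finset.prod_le_pow_card Finset.univ (fun l => circ a (c l) (c (cyc l))) _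
      fun l _ => Finset.le_sup (f := a) (Finset.mem_univ _)
  calc cycMean (circ a) k c ≤ (Finset.univ.sup a ^ k) ^ ((1 : ℝ) / k) :=
        NNReal.rpow_le_rpow h (by positivity)
    _ = Finset.univ.sup a := by rw [one_div, NNReal.pow_rpow_inv_natCast _ hk]

open Fin.CommRing in
theorem cycMean_circ_mul [NeZero n] (a : Fin n → ℝ≥0) (k : Fin n) :
    cycMean (circ a) n (fun l => l * k) = a k := by
  have hcyc (l : Fin n) : cyc l = l + 1 := by
    ext
    simp [cyc, Fin.val_add]
  have h (l : Fin n) : circ a (l * k) (cyc l * k) = a k := by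
    rw [hcyc, circ]
    congr 1
    ring
  simp only [cycMean, h, Finset.prod_const, Finset.card_univ, Fintype.card_fin, one_div]
  exact NNReal.pow_rpow_inv_natCast _ (NeZero.ne n)

theorem lam_circ [NeZero n] (a : Fin n → ℝ≥0) : lam (circ a) = Finset.univ.sup a := by
  refine le_antisymm (Finset.sup_le fun k hk => Finset.sup_le fun c _ => ?_)
    (Finset.sup_le fun k _ => ?_)
  · exact cycMean_circ_le a (Nat.one_le_iff_ne_zero.1 (Finset.mem_Icc.1 hk).1) c
  · rw [← cycMean_circ_mul a k]
    refine le_trans ?_ (Finset.le_sup (f := fun k => Finset.univ.sup fun c : Fin k → Fin n =>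
      cycMean (circ a) k c) (Finset.mem_Icc.2 ⟨NeZero.one_le, le_rfl⟩))
    exact Finset.le_sup (f := fun c : Fin n → Fin n => cycMean (circ a) n c) (Finset.mem_univ _)

theorem IsIntervalFam.le_and_le {S : Fin n → Set ℝ≥0} {lo hi : Fin n → ℝ≥0}
    (hS : IsIntervalFam S lo hi) {i : Fin n} {v : ℝ≥0} (hv : v ∈ S i) : lo i ≤ v ∧ v ≤ hi i := by
  rcases (hS i).2 with h | h | h | h <;> rw [h] at hv
  · exact hv
  · exact ⟨hv.1, hv.2.le⟩
  · exact ⟨hv.1.le, hv.2⟩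
  · exact ⟨hv.1.le, hv.2.le⟩

theorem sup_min_sup {alo ahi : Fin n → ℝ≥0} (hle : alo ≤ ahi) :
    (Finset.univ.sup fun k => min (Finset.univ.sup alo) (ahi k)) = Finset.univ.sup alo :=
  le_antisymm (Finset.sup_le fun _ _ => min_le_left _ _)
    (Finset.sup_mono_fun fun k _ => le_min (Finset.le_sup (Finset.mem_univ k)) (hle k))

/-- Transfer of attraction between circulants whose normalised weights are comparable. -/
theorem corr_iterate_succ_eq_smul [NeZero n] {a d x : Fin n → ℝ≥0}
    (ha : 0 < Finset.univ.sup a) (hd : 0 < Finset.univ.sup d)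
    (had : (Finset.univ.sup a)⁻¹ • a ≤ (Finset.univ.sup d)⁻¹ • d) {s : ℕ}
    (hx : (corr a)^[s + 1] x = Finset.univ.sup a • (corr a)^[s] x) {t : ℕ} (ht : n - 1 ≤ t) :
    (corr d)^[t + 1] x = Finset.univ.sup d • (corr d)^[t] x := by
  set m := Finset.univ.sup a with hm
  set μ := Finset.univ.sup d with hμ
  obtain ⟨k, -, hk⟩ := Finset.exists_mem_eq_sup Finset.univ Finset.univ_nonempty a
  have hb : (m⁻¹ • a) k = 1 := by
    simp [← hk, ← hm, ha.ne']
  have hc : μ⁻¹ • d ≤ 1 := fun j => by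
    have : d j ≤ μ := Finset.le_sup (Finset.mem_univ j)
    simpa using (inv_mul_le_one₀ hd).2 this
  have hb_iff := smul_corr_iterate_succ_eq_iff ha (m⁻¹ • a) x s
  have hc_iff := smul_corr_iterate_succ_eq_iff hd (μ⁻¹ • d) x t
  rw [smul_inv_smul₀ ha.ne'] at hb_iff
  rw [smul_inv_smul₀ hd.ne'] at hc_iff
  exact hc_iff.2 (corr_iterate_succ_eq_of_le had hb hc (hb_iff.1 hx) (by simpa using ht))

theorem inv_smul_le_inv_smul_min {a alo ahi : Fin n → ℝ≥0} (hlo : alo ≤ a) (hhi : a ≤ ahi)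
    (hpos : 0 < Finset.univ.sup alo) :
    (Finset.univ.sup a)⁻¹ • a ≤
      (Finset.univ.sup alo)⁻¹ • fun k => min (Finset.univ.sup alo) (ahi k) := by
  intro k
  have hle : Finset.univ.sup alo ≤ Finset.univ.sup a := Finset.sup_mono_fun fun k _ => hlo k
  have hk : a k ≤ Finset.univ.sup a := Finset.le_sup (Finset.mem_univ k)
  simp only [Pi.smul_apply, smul_eq_mul]
  rcases le_total (Finset.univ.sup alo) (ahi k) with h | h
  · rw [min_eq_left h, inv_mul_cancel₀ hpos.ne']
    exact (inv_mul_le_one₀ (hpos.trans_le hle)).2 hk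
  · rw [min_eq_right h]
    exact mul_le_mul' (inv_anti₀ hpos hle) (hhi k)

end MaxAlg
open MaxAlg in
/-- `C(𝐚)` (containing `Â`) is weakly tolerance `𝐗`-robust iff the system
`λ(Â)·(Â^{n²}⊗x) = Â^{n²+1}⊗x` is solvable with `x ∈ 𝐗`. -/
theorem weakly_tolerance_X_robust_iff
    (n : ℕ) (hn : 1 ≤ n)
    (S : Fin n → Set ℝ≥0) (lo hi : Fin n → ℝ≥0) (hS : IsIntervalFam S lo hi)
    (Sa : Fin n → Set ℝ≥0) (alo ahi : Fin n → ℝ≥0) (hSa : IsIntervalFam Sa alo ahi)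
    (hle : ∀ k, alo k ≤ ahi k)
    (hhat : Ahat alo ahi ∈ Cset Sa) :
    (∃ A ∈ Cset Sa, ∃ x ∈ box S, x ∈ Attr A) ↔
      ∃ x ∈ box S,
        (fun i => lam (Ahat alo ahi) * mvec (mpow (Ahat alo ahi) (n ^ 2)) x i) =
          mvec (mpow (Ahat alo ahi) (n ^ 2 + 1)) x := by
  have : NeZero n := ⟨Nat.one_le_iff_ne_zero.1 hn⟩
  have hiter (t : ℕ) (x : Fin n → ℝ≥0) : mvec (mpow (Ahat alo ahi) t) x =
      (corr fun k => min (Finset.univ.sup alo) (ahi k))^[t] x := by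
    rw [mvec_mpow, Ahat, mvec_circ]
  constructor
  · rintro ⟨_, ⟨a, ha, rfl⟩, x, hx, s, hs⟩
    refine ⟨x, hx, ?_⟩
    rw [mvec_mpow, mvec_mpow, mvec_circ, lam_circ] at hs
    rw [hiter, hiter, Ahat, lam_circ]
    have hsup := sup_min_sup hle
    rcases eq_zero_or_pos (Finset.univ.sup alo) with h0 | hpos
    · funext i
      rw [Function.iterate_succ_apply', hsup]
      simp only [h0, zero_mul]
      exact (le_antisymm (corr_le_iff.2 fun k => by simp) zero_le).symm
    · have hlo : alo ≤ a := fun k => (hSa.le_and_le (ha k)).1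
      have hhi : a ≤ ahi := fun k => (hSa.le_and_le (ha k)).2
      refine (corr_iterate_succ_eq_smul
        (hpos.trans_le (Finset.sup_mono_fun fun k _ => hlo k)) (hsup.symm ▸ hpos) ?_ hs
        ((Nat.sub_le n 1).trans (Nat.le_self_pow two_ne_zero n))).symm
      rw [hsup]
      exact inv_smul_le_inv_smul_min hlo hhi hpos
  · rintro ⟨x, hx, h⟩
    exact ⟨_, hhat, x, hx, n ^ 2, h.symm⟩
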